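/- The functions u(x) = cos(√2·x) + sech²(x)·cos(√2·x) − 2√2·tanh(x)·sin(√2·x) and v(x) = sech²(x)·cos(√2·x) satisfy for all x ∈ ℝ: −u''(x) + u(x) − 4·sech²(x)·u(x) − 2·sech²(x)·v(x) = 3·u(x) and v''(x) − v(x) + 2·sech²(x)·u(x) + 4·sech²(x)·v(x) = 3·v(x). (That is, this explicit bounded pair is a generalized plane-wave solution of the linearization at the cubic ground state at the resonant energy 3λ(3) = 3.) -/

import Mathlib

theorem hasDerivAt_tanh_sech (x : ℝ) :
    HasDerivAt Real.tanh (((Real.cosh x)⁻¹) ^ 2) x := by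
  have hc := (Real.cosh_pos x).ne'
  have h := (Real.hasDerivAt_sinh x).div (Real.hasDerivAt_cosh x) hc
  have he : Real.tanh = Real.sinh / Real.cosh := by
    funext y
    simp [Real.tanh_eq_sinh_div_cosh]
  rw [he]
  refine h.congr_deriv (Eq.symm ?_)
  rw [inv_pow, eq_div_iff (pow_ne_zero 2 hc), inv_mul_cancel₀ (pow_ne_zero 2 hc)]
  linarith [Real.cosh_sq x]

theorem hasDerivAt_sech_sq (x : ℝ) :
    HasDerivAt (fun y : ℝ => ((Real.cosh y)⁻¹) ^ 2)
      (-2 * ((Real.cosh x)⁻¹) ^ 2 * Real.tanh x) x := by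
  have hc := (Real.cosh_pos x).ne'
  refine (((Real.hasDerivAt_cosh x).inv hc).pow 2).congr_deriv ?_
  rw [Real.tanh_eq_sinh_div_cosh]
  simp only [Pi.inv_apply]
  norm_num
  field_simp

theorem tanh_sq_eq_one_sub_sech_sq (x : ℝ) :
    Real.tanh x ^ 2 = 1 - ((Real.cosh x)⁻¹) ^ 2 := by
  have hc := (Real.cosh_pos x).ne'
  rw [Real.tanh_eq_sinh_div_cosh]
  field_simp
  linarith [Real.cosh_sq x]

theorem hasDerivAt_cos_const_mul (a x : ℝ) :
    HasDerivAt (fun y : ℝ => Real.cos (a * y)) (-a * Real.sin (a * x)) x := by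
  refine ((hasDerivAt_id' x).const_mul a).cos.congr_deriv ?_
  ring

theorem hasDerivAt_sin_const_mul (a x : ℝ) :
    HasDerivAt (fun y : ℝ => Real.sin (a * y)) (a * Real.cos (a * x)) x := by
  refine ((hasDerivAt_id' x).const_mul a).sin.congr_deriv ?_
  ring

/-- the explicit bounded pair `g₃(3)` is a generalized plane-wave
solution of the linearization at the cubic ground state at energy `3`. -/
theorem stmt_11 (u v : ℝ → ℝ)
    (hu : u = fun x : ℝ =>
      Real.cos (Real.sqrt 2 * x) + ((Real.cosh x)⁻¹) ^ 2 * Real.cos (Real.sqrt 2 * x)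
        - 2 * Real.sqrt 2 * Real.tanh x * Real.sin (Real.sqrt 2 * x))
    (hv : v = fun x : ℝ => ((Real.cosh x)⁻¹) ^ 2 * Real.cos (Real.sqrt 2 * x)) :
    ∀ x : ℝ,
      (-(deriv (deriv u) x) + u x
        - 4 * ((Real.cosh x)⁻¹) ^ 2 * u x
        - 2 * ((Real.cosh x)⁻¹) ^ 2 * v x = 3 * u x) ∧
      (deriv (deriv v) x - v x
        + 2 * ((Real.cosh x)⁻¹) ^ 2 * u x
        + 4 * ((Real.cosh x)⁻¹) ^ 2 * v x = 3 * v x) := by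
  have hS := hasDerivAt_sech_sq
  have hT := hasDerivAt_tanh_sech
  have hC := hasDerivAt_cos_const_mul (Real.sqrt 2)
  have hN := hasDerivAt_sin_const_mul (Real.sqrt 2)
  have hv' : deriv v = fun x : ℝ =>
      -2 * ((Real.cosh x)⁻¹) ^ 2 * Real.tanh x * Real.cos (Real.sqrt 2 * x)
        + ((Real.cosh x)⁻¹) ^ 2 * (-Real.sqrt 2 * Real.sin (Real.sqrt 2 * x)) := by
    funext x
    rw [hv]
    exact ((hS x).mul (hC x)).deriv
  have hu' : deriv u = fun x : ℝ =>
      -Real.sqrt 2 * Real.sin (Real.sqrt 2 * x)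
        + (-2 * ((Real.cosh x)⁻¹) ^ 2 * Real.tanh x * Real.cos (Real.sqrt 2 * x)
          + ((Real.cosh x)⁻¹) ^ 2 * (-Real.sqrt 2 * Real.sin (Real.sqrt 2 * x)))
        - (2 * Real.sqrt 2 * ((Real.cosh x)⁻¹) ^ 2 * Real.sin (Real.sqrt 2 * x)
          + 2 * Real.sqrt 2 * Real.tanh x * (Real.sqrt 2 * Real.cos (Real.sqrt 2 * x))) := by
    funext x
    rw [hu]
    exact (((hC x).add ((hS x).mul (hC x))).sub
      (((hT x).const_mul (2 * Real.sqrt 2)).mul (hN x))).deriv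
  intro x
  have hv1 := (((hS x).const_mul (-2)).mul (hT x)).mul (hC x)
  have hv2 := (hS x).mul ((hN x).const_mul (-Real.sqrt 2))
  have hv'' := (hv1.add hv2).deriv
  have hu'' := ((((hN x).const_mul (-Real.sqrt 2)).add (hv1.add hv2)).sub
    ((((hS x).const_mul (2 * Real.sqrt 2)).mul (hN x)).add
      (((hT x).const_mul (2 * Real.sqrt 2)).mul ((hC x).const_mul (Real.sqrt 2))))).deriv
  replace hv'' := (congrArg (fun f => deriv f x) hv').trans hv''
  replace hu'' := (congrArg (fun f => deriv f x) hu').trans hu''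
  have hr : Real.sqrt 2 ^ 2 = 2 := Real.sq_sqrt zero_le_two
  have ht := tanh_sq_eq_one_sub_sech_sq x
  simp only [Pi.mul_apply] at hu'' hv''
  rw [hu'', hv'', hu, hv]
  dsimp only
  generalize Real.cos (Real.sqrt 2 * x) = c
  generalize Real.sin (Real.sqrt 2 * x) = s
  generalize Real.sqrt 2 = r at *
  generalize Real.tanh x = t at *
  generalize ((Real.cosh x)⁻¹) ^ 2 = q at *
  constructor <;> grind
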